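/- arXiv:1405.1345 — 2 statements merged into one kernel-verified Lean document; each statement's English description precedes it below -/
import Mathlib

section
/- Let (Γ, d) be a closed subset of ℝ^{d₂} and δ₀ > 0. The function g̃: R₂ → [0,∞] defined by g̃(r) = ∫_{Γ×[0,T]} |γ|^{2+δ₀} r(dγ,dt) is a tightness function on R₂: it is measurable and for every c ∈ [0,∞), the sublevel set {r ∈ R₂ : g̃(r) ≤ c} is precompact in R₂. -/
open MeasureTheory ENNReal Filter

/-- The space `R` of deterministic relaxed controls on `Γ × [0,T]`: finite
measures on `Γ × [0,T]` whose time marginal is Lebesgue measure, equipped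
(as a subtype of `FiniteMeasure`) with the topology of weak convergence. -/
abbrev RelCtrl (d₂ : ℕ) (T : ℝ) (Γ : Set (EuclideanSpace ℝ (Fin d₂))) : Type :=
  {r : FiniteMeasure (↥Γ × ↥(Set.Icc (0:ℝ) T)) //
    ∀ t ∈ Set.Icc (0:ℝ) T,
      (r : Measure (↥Γ × ↥(Set.Icc (0:ℝ) T)))
        (Set.univ ×ˢ {s : ↥(Set.Icc (0:ℝ) T) | (s : ℝ) ≤ t}) = ENNReal.ofReal t}

/-- The `(2+δ₀)`-moment functional on relaxed controls. -/
noncomputable def g2δ (d₂ : ℕ) (T : ℝ) (Γ : Set (EuclideanSpace ℝ (Fin d₂)))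
    (δ₀ : ℝ) (r : RelCtrl d₂ T Γ) : ℝ≥0∞ :=
  ∫⁻ p, (ENNReal.ofReal ‖(p.1 : EuclideanSpace ℝ (Fin d₂))‖) ^ ((2:ℝ) + δ₀)
    ∂((r.1 : Measure (↥Γ × ↥(Set.Icc (0:ℝ) T))))

/-- The second-moment functional on relaxed controls. -/
noncomputable def g2 (d₂ : ℕ) (T : ℝ) (Γ : Set (EuclideanSpace ℝ (Fin d₂)))
    (r : RelCtrl d₂ T Γ) : ℝ≥0∞ :=
  ∫⁻ p, ENNReal.ofReal (‖(p.1 : EuclideanSpace ℝ (Fin d₂))‖ ^ 2)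
    ∂((r.1 : Measure (↥Γ × ↥(Set.Icc (0:ℝ) T))))

open scoped NNReal

/-- Truncation of a continuous function at level `M`. -/
noncomputable def truncBCF {X : Type*} [TopologicalSpace X] (f : X → ℝ≥0) (hf : Continuous f)
    (M : ℕ) : BoundedContinuousFunction X ℝ≥0 :=
  BoundedContinuousFunction.mkOfBound ⟨fun x => min (f x) M, by fun_prop⟩ M (by
    intro x y
    have h1 : ((min (f x) (M : ℝ≥0) : ℝ≥0) : ℝ) ≤ M := by
      exact_mod_cast min_le_right (f x) (M : ℝ≥0)
    have h2 : ((min (f y) (M : ℝ≥0) : ℝ≥0) : ℝ) ≤ M := by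
      exact_mod_cast min_le_right (f y) (M : ℝ≥0)
    have h3 := (min (f x) (M : ℝ≥0)).2
    have h4 := (min (f y) (M : ℝ≥0)).2
    rw [NNReal.dist_eq, abs_le]
    simp only [ContinuousMap.coe_mk]
    constructor <;> simp only [NNReal.val_eq_coe] at * <;> linarith)

lemma truncBCF_apply {X : Type*} [TopologicalSpace X] (f : X → ℝ≥0) (hf : Continuous f)
    (M : ℕ) (x : X) : truncBCF f hf M x = min (f x) M := rfl

lemma iSup_min_nat (a : ℝ≥0) : (⨆ M : ℕ, ((min a (M : ℝ≥0) : ℝ≥0) : ℝ≥0∞)) = a := by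
  apply le_antisymm
  · exact iSup_le fun M => by exact_mod_cast min_le_left _ _
  · obtain ⟨M, hM⟩ := exists_nat_ge a
    refine le_iSup_of_le M ?_
    rw [min_eq_left hM]

lemma lintegral_eq_iSup_trunc {X : Type*} [TopologicalSpace X] [MeasurableSpace X]
    [OpensMeasurableSpace X] (μ : Measure X) (f : X → ℝ≥0) (hf : Continuous f) :
    ∫⁻ x, (f x : ℝ≥0∞) ∂μ = ⨆ M : ℕ, ∫⁻ x, (truncBCF f hf M x : ℝ≥0∞) ∂μ := by
  rw [← lintegral_iSup]
  · refine lintegral_congr fun x => ?_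
    simp only [truncBCF_apply]
    exact (iSup_min_nat (f x)).symm
  · intro M
    exact (ENNReal.continuous_coe.comp (truncBCF f hf M).continuous).measurable
  · intro M N h x
    simp only [truncBCF_apply]
    have : (M : ℝ≥0) ≤ N := by exact_mod_cast h
    exact_mod_cast min_le_min_left _ this

lemma isClosed_relCtrl (d₂ : ℕ) (T : ℝ) (Γ : Set (EuclideanSpace ℝ (Fin d₂))) :
    IsClosed {r : FiniteMeasure (↥Γ × ↥(Set.Icc (0:ℝ) T)) |
      ∀ t ∈ Set.Icc (0:ℝ) T,
      (r : Measure (↥Γ × ↥(Set.Icc (0:ℝ) T)))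
        (Set.univ ×ˢ {s : ↥(Set.Icc (0:ℝ) T) | (s : ℝ) ≤ t}) = ENNReal.ofReal t} := by
  set R := {r : FiniteMeasure (↥Γ × ↥(Set.Icc (0:ℝ) T)) |
      ∀ t ∈ Set.Icc (0:ℝ) T,
      (r : Measure (↥Γ × ↥(Set.Icc (0:ℝ) T)))
        (Set.univ ×ˢ {s : ↥(Set.Icc (0:ℝ) T) | (s : ℝ) ≤ t}) = ENNReal.ofReal t} with hR
  rcases R.eq_empty_or_nonempty with h | ⟨r₀, h₀⟩
  · rw [h]; exact isClosed_empty
  have key : ∀ (r : FiniteMeasure (↥Γ × ↥(Set.Icc (0:ℝ) T))) (t : ↥(Set.Icc (0:ℝ) T)),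
      ((r.map Prod.snd : FiniteMeasure _) : Measure ↥(Set.Icc (0:ℝ) T)) (Set.Iic t) =
      (r : Measure (↥Γ × ↥(Set.Icc (0:ℝ) T)))
        (Set.univ ×ˢ {s : ↥(Set.Icc (0:ℝ) T) | (s : ℝ) ≤ t}) := by
    intro r t
    rw [FiniteMeasure.toMeasure_map, Measure.map_apply measurable_snd measurableSet_Iic]
    congr 1
    ext p
    simp [← Subtype.coe_le_coe]
  have : R = (fun r : FiniteMeasure (↥Γ × ↥(Set.Icc (0:ℝ) T)) =>
      r.map Prod.snd) ⁻¹' {r₀.map Prod.snd} := by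
    ext r
    simp only [Set.mem_preimage, Set.mem_singleton_iff]
    constructor
    · intro h
      apply FiniteMeasure.toMeasure_injective
      apply Measure.ext_of_Iic
      intro t
      rw [key, key, h t t.2, h₀ t t.2]
    · intro h t ht
      have := key r ⟨t, ht⟩
      rw [h, key r₀ ⟨t, ht⟩] at this
      rw [← h₀ t ht]
      exact this.symm
  rw [this]
  exact isClosed_singleton.preimage (FiniteMeasure.continuous_map continuous_snd)

lemma continuous_lint_relCtrl (d₂ : ℕ) (T : ℝ) (Γ : Set (EuclideanSpace ℝ (Fin d₂)))
    (f : BoundedContinuousFunction (↥Γ × ↥(Set.Icc (0:ℝ) T)) ℝ≥0) :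
    Continuous fun r : RelCtrl d₂ T Γ =>
      ∫⁻ p, (f p : ℝ≥0∞) ∂((r.1 : Measure (↥Γ × ↥(Set.Icc (0:ℝ) T)))) :=
  (FiniteMeasure.continuous_lintegral_boundedContinuousFunction f).comp continuous_subtype_val

lemma g2δ_eq (d₂ : ℕ) (T : ℝ) (Γ : Set (EuclideanSpace ℝ (Fin d₂)))
    (δ₀ : ℝ) (hδ : 0 < δ₀) (r : RelCtrl d₂ T Γ) : g2δ d₂ T Γ δ₀ r =
    ∫⁻ p, (((‖(p.1 : EuclideanSpace ℝ (Fin d₂))‖₊ ^ ((2:ℝ) + δ₀) : ℝ≥0)) : ℝ≥0∞)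
      ∂((r.1 : Measure (↥Γ × ↥(Set.Icc (0:ℝ) T)))) := by
  unfold g2δ
  refine lintegral_congr fun p => ?_
  rw [ofReal_norm, enorm_eq_nnnorm, ENNReal.coe_rpow_of_nonneg _ (by linarith)]

lemma g2_eq (d₂ : ℕ) (T : ℝ) (Γ : Set (EuclideanSpace ℝ (Fin d₂)))
    (r : RelCtrl d₂ T Γ) : g2 d₂ T Γ r =
    ∫⁻ p, (((‖(p.1 : EuclideanSpace ℝ (Fin d₂))‖₊ ^ 2 : ℝ≥0)) : ℝ≥0∞)
      ∂((r.1 : Measure (↥Γ × ↥(Set.Icc (0:ℝ) T)))) := by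
  unfold g2
  refine lintegral_congr fun p => ?_
  rw [ENNReal.ofReal_pow (norm_nonneg _), ofReal_norm, enorm_eq_nnnorm, ENNReal.coe_pow]

/-- The pointwise tail bound. -/
lemma tail_bound (δ₀ : ℝ) (hδ : 0 < δ₀) (a : ℝ≥0) (M : ℕ) :
    a ^ 2 ≤ min (a ^ 2) (M : ℝ≥0) + ((M : ℝ≥0) ^ (δ₀ / 2))⁻¹ * a ^ ((2:ℝ) + δ₀) ∨ M = 0 := by
  rcases Nat.eq_zero_or_pos M with h | hM
  · right; exact h
  left
  rcases le_total (a ^ 2) (M : ℝ≥0) with h | h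
  · rw [min_eq_left h]; exact le_self_add
  · have hMp : (0 : ℝ≥0) < (M : ℝ≥0) ^ (δ₀ / 2) := NNReal.rpow_pos (by exact_mod_cast hM)
    refine le_trans ?_ le_add_self
    have h1 : (M : ℝ≥0) ^ (δ₀ / 2) ≤ a ^ δ₀ := by
      calc (M : ℝ≥0) ^ (δ₀ / 2) ≤ (a ^ 2) ^ (δ₀ / 2) := NNReal.rpow_le_rpow h (by linarith)
        _ = a ^ δ₀ := by
          rw [← NNReal.rpow_natCast, ← NNReal.rpow_mul]; congr 1; push_cast; ring
    have ha : a ≠ 0 := by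
      rintro rfl
      have : (0 : ℝ≥0) < M := by exact_mod_cast hM
      simp at h
      omega
    rw [NNReal.rpow_add ha, NNReal.rpow_two, ← div_eq_inv_mul, le_div_iff₀ hMp]
    gcongr

lemma sublevel_compact (d₂ : ℕ) (T δ₀ : ℝ) (hT : 0 < T) (hδ : 0 < δ₀)
    (Γ : Set (EuclideanSpace ℝ (Fin d₂))) (hΓ : IsClosed Γ) (c : ℝ≥0∞) (hc : c ≠ ⊤) :
    IsCompact (closure {r : RelCtrl d₂ T Γ | g2δ d₂ T Γ δ₀ r ≤ c}) := by
  lift c to ℝ≥0 using hc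
  let K : ℕ → Set (↥Γ × ↥(Set.Icc (0:ℝ) T)) := fun n =>
    ((Subtype.val : Γ → EuclideanSpace ℝ (Fin d₂)) ⁻¹' Metric.closedBall 0 ((n : ℝ) + 1)) ×ˢ
      Set.univ
  have hK : ∀ n, IsCompact (K n) := fun n =>
    (hΓ.isClosedEmbedding_subtypeVal.isCompact_preimage (isCompact_closedBall _ _)).prod
      isCompact_univ
  let u : ℕ → ℝ≥0 := fun n => c / ((n : ℝ≥0) + 1)
  have hu : Tendsto u atTop (nhds 0) := by
    have h1 : Tendsto (fun n : ℕ => (c : ℝ) / ((n : ℝ) + 1)) atTop (nhds 0) :=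
      tendsto_const_div_atTop_nhds_zero_nat (c : ℝ) |>.comp (tendsto_add_atTop_nat 1) |>.congr
        (by intro n; simp)
    rw [← NNReal.tendsto_coe]
    refine h1.congr ?_
    intro n; simp [u]
  have hcomp := isCompact_setOfPred_finiteMeasure_mass_le_compl_isCompact_le
    (E := ↥Γ × ↥(Set.Icc (0:ℝ) T)) (u := u) (K := K) T.toNNReal hu hK (Or.inl inferInstance)
  have hpre := (isClosed_relCtrl d₂ T Γ).isClosedEmbedding_subtypeVal.isCompact_preimage hcomp
  refine hpre.closure_of_subset ?_
  intro r hr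
  have hr' : g2δ d₂ T Γ δ₀ r ≤ c := hr
  refine ⟨?_, fun n => ?_⟩
  · rw [← ENNReal.coe_le_coe, FiniteMeasure.ennreal_mass]
    have := r.2 T ⟨hT.le, le_rfl⟩
    have hs : (Set.univ ×ˢ {s : ↥(Set.Icc (0:ℝ) T) | (s : ℝ) ≤ T} :
        Set (↥Γ × ↥(Set.Icc (0:ℝ) T))) = Set.univ := by
      ext p; simp [p.2.2.2]
    rw [hs] at this
    exact this.le
  · rw [← ENNReal.coe_le_coe, FiniteMeasure.ennreal_coeFn_eq_coeFn_toMeasure]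
    have hpos : ((n : ℝ≥0) + 1) ≠ 0 := by positivity
    simp only [u]
    rw [ENNReal.coe_div hpos, ENNReal.le_div_iff_mul_le (by left; exact_mod_cast hpos)
      (by left; exact ENNReal.coe_ne_top), mul_comm]
    refine le_trans ?_ hr'
    rw [g2δ_eq d₂ T Γ δ₀ hδ]
    have hsub : (K n)ᶜ ⊆ {p : ↥Γ × ↥(Set.Icc (0:ℝ) T) | (((n : ℝ≥0) + 1 : ℝ≥0) : ℝ≥0∞) ≤
        (((‖(p.1 : EuclideanSpace ℝ (Fin d₂))‖₊ ^ ((2:ℝ) + δ₀) : ℝ≥0)) : ℝ≥0∞)} := by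
      intro p hp
      simp only [K, Set.mem_compl_iff, Set.mem_prod, Set.mem_preimage, mem_closedBall_zero_iff,
        Set.mem_univ, and_true, not_le] at hp
      have h1 : (n : ℝ≥0) + 1 ≤ ‖(p.1 : EuclideanSpace ℝ (Fin d₂))‖₊ := by
        rw [← NNReal.coe_le_coe]; push_cast; exact hp.le
      have h2 : (1 : ℝ≥0) ≤ ‖(p.1 : EuclideanSpace ℝ (Fin d₂))‖₊ := le_trans (by simp) h1
      have h3 : (n : ℝ≥0) + 1 ≤ ‖(p.1 : EuclideanSpace ℝ (Fin d₂))‖₊ ^ ((2:ℝ) + δ₀) :=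
        h1.trans (by
          conv_lhs => rw [← NNReal.rpow_one ‖(p.1 : EuclideanSpace ℝ (Fin d₂))‖₊]
          exact NNReal.rpow_le_rpow_of_exponent_le h2 (by linarith))
      exact ENNReal.coe_le_coe.2 h3
    refine le_trans (mul_le_mul_right (measure_mono hsub) _) ?_
    refine mul_meas_ge_le_lintegral ?_ _
    refine (ENNReal.continuous_coe.comp ?_).measurable
    exact (NNReal.continuous_rpow_const (by linarith)).comp
      (by fun_prop : Continuous fun p : ↥Γ × ↥(Set.Icc (0:ℝ) T) =>
        ‖(p.1 : EuclideanSpace ℝ (Fin d₂))‖₊)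

/-- `g̃(r) = ∫ |γ|^{2+δ₀} r(dγ,dt)` is a tightness function on `R₂`: it is
(Borel) measurable and each sublevel set `{g̃ ≤ c}`, `c < ∞`, is precompact
in `R₂`, i.e. it is precompact in `R` (weak topology) and along any sequence
in the sublevel set converging in `R` the limit has a finite second moment and
the second moments converge. -/
theorem stmt_4 (d₂ : ℕ) (T δ₀ : ℝ) (hT : 0 < T) (hδ : 0 < δ₀)
    (Γ : Set (EuclideanSpace ℝ (Fin d₂))) (hΓ : IsClosed Γ) :
    Measurable[borel (RelCtrl d₂ T Γ)] (g2δ d₂ T Γ δ₀) ∧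
    ∀ c : ℝ≥0∞, c ≠ ⊤ →
      (IsCompact (closure {r : RelCtrl d₂ T Γ | g2δ d₂ T Γ δ₀ r ≤ c}) ∧
       ∀ (rn : ℕ → RelCtrl d₂ T Γ) (r : RelCtrl d₂ T Γ),
         (∀ n, g2δ d₂ T Γ δ₀ (rn n) ≤ c) →
         Tendsto rn atTop (nhds r) →
         (g2 d₂ T Γ r ≠ ⊤ ∧
          Tendsto (fun n => g2 d₂ T Γ (rn n)) atTop (nhds (g2 d₂ T Γ r)))) := by
  have hcδ : Continuous fun p : ↥Γ × ↥(Set.Icc (0:ℝ) T) =>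
      ‖(p.1 : EuclideanSpace ℝ (Fin d₂))‖₊ ^ ((2:ℝ) + δ₀) :=
    (NNReal.continuous_rpow_const (by linarith)).comp
      (by fun_prop : Continuous fun p : ↥Γ × ↥(Set.Icc (0:ℝ) T) =>
        ‖(p.1 : EuclideanSpace ℝ (Fin d₂))‖₊)
  have hc2 : Continuous fun p : ↥Γ × ↥(Set.Icc (0:ℝ) T) =>
      ‖(p.1 : EuclideanSpace ℝ (Fin d₂))‖₊ ^ 2 := by fun_prop
  have Eδ : ∀ r : RelCtrl d₂ T Γ, g2δ d₂ T Γ δ₀ r =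
      ⨆ M : ℕ, ∫⁻ p, (truncBCF _ hcδ M p : ℝ≥0∞)
        ∂((r.1 : Measure (↥Γ × ↥(Set.Icc (0:ℝ) T)))) := fun r => by
    rw [g2δ_eq d₂ T Γ δ₀ hδ, lintegral_eq_iSup_trunc _ _ hcδ]
  have E2 : ∀ r : RelCtrl d₂ T Γ, g2 d₂ T Γ r =
      ⨆ M : ℕ, ∫⁻ p, (truncBCF _ hc2 M p : ℝ≥0∞)
        ∂((r.1 : Measure (↥Γ × ↥(Set.Icc (0:ℝ) T)))) := fun r => by
    rw [g2_eq d₂ T Γ, lintegral_eq_iSup_trunc _ _ hc2]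
  refine ⟨?_, fun c hc => ⟨sublevel_compact d₂ T δ₀ hT hδ Γ hΓ c hc, ?_⟩⟩
  · let _ : MeasurableSpace (RelCtrl d₂ T Γ) := borel _
    have _ : BorelSpace (RelCtrl d₂ T Γ) := ⟨rfl⟩
    rw [show g2δ d₂ T Γ δ₀ = fun r => _ from funext Eδ]
    exact Measurable.iSup fun M => (continuous_lint_relCtrl d₂ T Γ _).measurable
  intro rn r hrn hlim
  have hr : g2δ d₂ T Γ δ₀ r ≤ c := by
    rw [Eδ]
    refine iSup_le fun M => ?_
    refine le_of_tendsto (((continuous_lint_relCtrl d₂ T Γ _).tendsto r).comp hlim)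
      (Eventually.of_forall fun n => ?_)
    refine le_trans ?_ (hrn n)
    rw [Eδ]
    exact le_iSup (fun M : ℕ => ∫⁻ p, (truncBCF _ hcδ M p : ℝ≥0∞)
        ∂(((rn n).1 : Measure (↥Γ × ↥(Set.Icc (0:ℝ) T))))) M
  let ε : ℕ → ℝ≥0 := fun M => (((M + 1 : ℕ) : ℝ≥0) ^ (δ₀ / 2))⁻¹
  have tail : ∀ (s : RelCtrl d₂ T Γ) (M : ℕ), g2δ d₂ T Γ δ₀ s ≤ c →
      g2 d₂ T Γ s ≤ ∫⁻ p, (truncBCF _ hc2 (M + 1) p : ℝ≥0∞)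
        ∂((s.1 : Measure (↥Γ × ↥(Set.Icc (0:ℝ) T)))) + ε M * c := by
    intro s M hs
    rw [g2_eq]
    rw [g2δ_eq d₂ T Γ δ₀ hδ] at hs
    refine le_trans ?_ (add_le_add_right (mul_le_mul_right hs (ε M : ℝ≥0∞)) _)
    have m1 : Measurable fun p : ↥Γ × ↥(Set.Icc (0:ℝ) T) =>
        (((‖(p.1 : EuclideanSpace ℝ (Fin d₂))‖₊ ^ ((2:ℝ) + δ₀) : ℝ≥0)) : ℝ≥0∞) :=
      (ENNReal.continuous_coe.comp hcδ).measurable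
    have m2 : Measurable fun p : ↥Γ × ↥(Set.Icc (0:ℝ) T) =>
        (truncBCF _ hc2 (M + 1) p : ℝ≥0∞) :=
      (ENNReal.continuous_coe.comp (truncBCF _ hc2 (M + 1)).continuous).measurable
    rw [← lintegral_const_mul _ m1, ← lintegral_add_left m2]
    refine lintegral_mono fun p => ?_
    have := (tail_bound δ₀ hδ ‖(p.1 : EuclideanSpace ℝ (Fin d₂))‖₊ (M + 1)).resolve_right
      (Nat.succ_ne_zero M)
    rw [truncBCF_apply, ← ENNReal.coe_mul, ← ENNReal.coe_add]
    exact ENNReal.coe_le_coe.2 this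
  have hε : Tendsto (fun M => (ε M : ℝ≥0∞) * c) atTop (nhds 0) := by
    have h1 : Tendsto ε atTop (nhds 0) := by
      have : Tendsto (fun M : ℕ => ((M + 1 : ℕ) : ℝ≥0) ^ (δ₀ / 2)) atTop atTop :=
        (NNReal.tendsto_rpow_atTop (by linarith)).comp
          (tendsto_natCast_atTop_atTop.comp (tendsto_add_atTop_nat 1))
      exact this.inv_tendsto_atTop
    have h2 := ENNReal.Tendsto.mul_const (b := c) (ENNReal.tendsto_coe.2 h1) (Or.inr hc)
    simpa using h2
  have hfin : g2 d₂ T Γ r ≠ ⊤ := by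
    refine ne_top_of_le_ne_top ?_ (tail r 0 hr)
    refine ENNReal.add_ne_top.2 ⟨?_, ENNReal.mul_ne_top ENNReal.coe_ne_top hc⟩
    exact (BoundedContinuousFunction.lintegral_lt_top_of_nnreal _ _).ne
  refine ⟨hfin, tendsto_order.2 ⟨fun a ha => ?_, fun b hb => ?_⟩⟩
  · rw [E2, lt_iSup_iff] at ha
    obtain ⟨M, hM⟩ := ha
    have := (((continuous_lint_relCtrl d₂ T Γ _).tendsto r).comp hlim).eventually_const_lt hM
    filter_upwards [this] with n hn
    refine lt_of_lt_of_le hn ?_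
    rw [E2]
    exact le_iSup (fun M : ℕ => ∫⁻ p, (truncBCF _ hc2 M p : ℝ≥0∞)
        ∂(((rn n).1 : Measure (↥Γ × ↥(Set.Icc (0:ℝ) T))))) M
  · have h1 : Tendsto (fun M => g2 d₂ T Γ r + (ε M : ℝ≥0∞) * c) atTop (nhds (g2 d₂ T Γ r)) := by
      simpa using tendsto_const_nhds.add hε
    obtain ⟨M, hM⟩ := (h1.eventually_lt_const hb).exists
    have h2 : ∫⁻ p, (truncBCF _ hc2 (M + 1) p : ℝ≥0∞)
        ∂((r.1 : Measure (↥Γ × ↥(Set.Icc (0:ℝ) T)))) + (ε M : ℝ≥0∞) * c < b := by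
      refine lt_of_le_of_lt (add_le_add_left ?_ _) hM
      rw [E2]
      exact le_iSup (fun M : ℕ => ∫⁻ p, (truncBCF _ hc2 M p : ℝ≥0∞)
        ∂((r.1 : Measure (↥Γ × ↥(Set.Icc (0:ℝ) T))))) (M + 1)
    have h3 := ((((continuous_lint_relCtrl d₂ T Γ (truncBCF _ hc2 (M + 1))).tendsto r).comp
      hlim).add_const ((ε M : ℝ≥0∞) * c)).eventually_lt_const h2
    filter_upwards [h3] with n hn
    exact lt_of_le_of_lt (tail (rn n) M (hrn n)) hn
end

section
/- Let S be a Polish space with a complete compatible metric, and let g: S → [0,∞] be a tightness function on S (measurable with precompact sublevel sets). Then the function G: P(S) → [0,∞] defined by G(Θ) = ∫_S g dΘ is a tightness function on P(S), i.e. for every c ∈ [0,∞) the set {Θ ∈ P(S) : G(Θ) ≤ c} is precompact in the topology of weak convergence. -/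
open MeasureTheory ENNReal

/-- If `g : S → [0,∞]` is a tightness function on a Polish space `S`
(measurable with precompact sublevel sets), then `Θ ↦ ∫ g dΘ` is a tightness
function on `P(S)` with the topology of weak convergence. -/
theorem stmt_5 {S : Type*} [MetricSpace S] [CompleteSpace S]
    [TopologicalSpace.SeparableSpace S] [MeasurableSpace S] [BorelSpace S]
    (g : S → ℝ≥0∞) (hg : Measurable g)
    (hcpt : ∀ c : ℝ≥0∞, c ≠ ⊤ → IsCompact (closure {s : S | g s ≤ c})) :
    ∀ c : ℝ≥0∞, c ≠ ⊤ →
      IsCompact (closure {Θ : ProbabilityMeasure S | ∫⁻ s, g s ∂(Θ : Measure S) ≤ c}) := by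
  intro c hc
  apply isCompact_closure_of_isTightMeasureSet
  rw [isTightMeasureSet_iff_exists_isCompact_measure_compl_le]
  intro ε hε
  by_cases hε' : ε = ⊤
  · exact ⟨∅, isCompact_empty, fun μ _ => by simp [hε']⟩
  have hM0 : (c + 1) / ε ≠ 0 := by
    simp [ENNReal.div_eq_zero_iff, hε']
  have hM : (c + 1) / ε ≠ ⊤ :=
    ENNReal.div_ne_top (by simp [hc]) hε.ne'
  refine ⟨_, hcpt _ hM, ?_⟩
  rintro μ ⟨Θ, hΘ, rfl⟩
  have hΘ' : ∫⁻ s, g s ∂(Θ : Measure S) ≤ c := hΘ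
  calc (Θ : Measure S) (closure {s : S | g s ≤ (c + 1) / ε})ᶜ
      ≤ (Θ : Measure S) {s | (c + 1) / ε ≤ g s} := by
        apply measure_mono
        intro s hs
        by_contra h
        have h1 : g s ≤ (c + 1) / ε := le_of_lt (not_le.mp h)
        have h2 : s ∈ {s : S | g s ≤ (c + 1) / ε} := h1
        exact hs (subset_closure h2)
    _ ≤ (∫⁻ s, g s ∂(Θ : Measure S)) / ((c + 1) / ε) :=
        meas_ge_le_lintegral_div hg.aemeasurable hM0 hM
    _ ≤ ε := by
        rw [ENNReal.div_le_iff hM0 hM, ENNReal.mul_div_cancel hε.ne' hε']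
        exact hΘ'.trans le_self_add
end
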